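/- Let p be a probability distribution on a finite set S of size S₀ and let p̂_N be the empirical distribution from N i.i.d. samples. Then for any ε > 0, if N ≥ (4/ε²)(1 − 1/S₀), the probability that ‖p̂_N − p‖₂ ≥ ε is at most exp(−ε²N/2). -/

import Mathlib

open MeasureTheory Finset Real

/-- The empirical distribution of `N` samples. -/
noncomputable def empDist {S : Type*} [Fintype S] [DecidableEq S] {N : ℕ}
    (ω : Fin N → S) (s : S) : ℝ :=
  (N : ℝ)⁻¹ * ∑ i, if ω i = s then (1 : ℝ) else 0

/-- Hoeffding's lemma for a finitely supported random variable, with the squared range bounded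
by twice the squared Euclidean norm. -/
lemma sum_mul_exp_le_exp_add_sum_sq {S : Type*} [Fintype S]
    {p : S → ℝ} (hp0 : ∀ a, 0 ≤ p a) (hp1 : ∑ a, p a = 1) (w : S → ℝ) :
    ∑ a, p a * exp (w a) ≤ exp (∑ a, p a * w a + (∑ a, w a ^ 2) / 4) := by
  classical
  let _ : MeasurableSpace S := ⊤
  have hne : Nonempty S := by
    by_contra h
    rw [not_nonempty_iff] at h
    simp at hp1
  have hsum : ∑ a, ENNReal.ofReal (p a) = 1 := by
    rw [← ENNReal.ofReal_sum_of_nonneg fun a _ => hp0 a, hp1, ENNReal.ofReal_one]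
  let P : PMF S := PMF.ofFintype (fun a => ENNReal.ofReal (p a)) hsum
  have hint : ∀ f : S → ℝ, ∫ a, f a ∂P.toMeasure = ∑ a, p a * f a := fun f => by
    rw [PMF.integral_eq_sum]
    simp [P, hp0]
  obtain ⟨b, hb⟩ := Finite.exists_min w
  obtain ⟨c, hc⟩ := Finite.exists_max w
  have hsub := ProbabilityTheory.hasSubgaussianMGF_of_mem_Icc (μ := P.toMeasure) (X := w)
    (a := w b) (b := w c) (measurable_from_top.aemeasurable)
    (Filter.Eventually.of_forall fun a => ⟨hb a, hc a⟩)
  have hmgf := hsub.mgf_le 1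
  rw [ProbabilityTheory.mgf, hint, hint] at hmgf
  simp only [one_mul] at hmgf
  have hrange : (w c - w b) ^ 2 ≤ 2 * ∑ a, w a ^ 2 := by
    by_cases hbc : b = c
    · subst hbc
      have : 0 ≤ ∑ a, w a ^ 2 := sum_nonneg fun a _ => sq_nonneg _
      simpa using this
    · have : ∑ a ∈ {b, c}, w a ^ 2 ≤ ∑ a, w a ^ 2 :=
        sum_le_sum_of_subset_of_nonneg (subset_univ _) fun a _ _ => sq_nonneg _
      rw [sum_pair hbc] at this
      nlinarith [sq_nonneg (w b + w c)]
  have hle : ∑ a, p a * exp (w a - ∑ a, p a * w a) ≤ exp ((∑ a, w a ^ 2) / 4) := by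
    refine hmgf.trans (exp_le_exp.2 ?_)
    simp only [NNReal.coe_pow, NNReal.coe_div, coe_nnnorm, NNReal.coe_ofNat, Real.norm_eq_abs]
    rw [div_pow, sq_abs]
    linarith
  calc ∑ a, p a * exp (w a)
      = exp (∑ a, p a * w a) * ∑ a, p a * exp (w a - ∑ a, p a * w a) := by
        rw [mul_sum]
        refine sum_congr rfl fun a _ => ?_
        rw [mul_left_comm, ← exp_add]
        ring_nf
    _ ≤ _ := by
        rw [exp_add]
        gcongr

/-- The squared norm of `x` shifted by a centred indicator vector. -/
lemma sum_add_indicator_sub_sq {S : Type*} [Fintype S] [DecidableEq S] (p x : S → ℝ) (a : S) :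
    ∑ s, (x s + ((if a = s then 1 else 0) - p s)) ^ 2 =
      ∑ s, x s ^ 2 + 2 * (x a - ∑ s, p s * x s) + (1 + ∑ s, p s ^ 2 - 2 * p a) := by
  have h : ∀ s, (x s + ((if a = s then 1 else 0) - p s)) ^ 2 =
      x s ^ 2 - 2 * (p s * x s) + p s ^ 2 + if a = s then 2 * x s + 1 - 2 * p s else 0 := by
    intro s
    split_ifs <;> ring
  simp only [h, sum_add_distrib, sum_sub_distrib, ← mul_sum, sum_ite_eq, mem_univ, if_true]
  ring

/-- One step of the exponential-moment recursion for sums of centred indicator vectors. -/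
lemma sum_mul_exp_sq_add_indicator_le {S : Type*} [Fintype S] [DecidableEq S]
    {p : S → ℝ} (hp0 : ∀ a, 0 ≤ p a) (hp1 : ∑ a, p a = 1) {l : ℝ} (hl0 : 0 < l) (hl1 : l < 1)
    (x : S → ℝ) :
    ∑ a, p a * exp (l * ∑ s, (x s + ((if a = s then 1 else 0) - p s)) ^ 2) ≤
      exp l * exp (l / (1 - l) * ∑ s, x s ^ 2) := by
  have hH := sum_mul_exp_le_exp_add_sum_sq hp0 hp1 fun a => 2 * l * (x a - p a)
  set X := ∑ s, x s ^ 2 with hX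
  set q := ∑ s, p s ^ 2 with hq
  set c := ∑ s, p s * x s with hc
  have hmean : ∑ a, p a * (2 * l * (x a - p a)) = 2 * l * (c - q) := by
    rw [hc, hq, ← sum_sub_distrib, mul_sum]
    exact sum_congr rfl fun a _ => by ring
  have hnorm : ∑ a, (2 * l * (x a - p a)) ^ 2 = 4 * l ^ 2 * (X - 2 * c + q) := by
    rw [hX, hc, hq, mul_sum, ← sum_sub_distrib, ← sum_add_distrib, mul_sum]
    exact sum_congr rfl fun a _ => by ring
  have hsq : 0 ≤ l ^ 2 * X + 2 * l * (1 - l) * c + (1 - l) ^ 2 * q := by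
    have : l ^ 2 * X + 2 * l * (1 - l) * c + (1 - l) ^ 2 * q =
        ∑ s, (l * x s + (1 - l) * p s) ^ 2 := by
      rw [hX, hc, hq, mul_sum, mul_sum, mul_sum, ← sum_add_distrib, ← sum_add_distrib]
      exact sum_congr rfl fun a _ => by ring
    rw [this]
    exact sum_nonneg fun a _ => sq_nonneg _
  rw [hmean, hnorm] at hH
  calc ∑ a, p a * exp (l * ∑ s, (x s + ((if a = s then 1 else 0) - p s)) ^ 2)
      = exp (l * (X + 1 + q - 2 * c)) * ∑ a, p a * exp (2 * l * (x a - p a)) := by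
        rw [mul_sum]
        refine sum_congr rfl fun a _ => ?_
        rw [sum_add_indicator_sub_sq, ← hX, ← hq, ← hc, mul_left_comm, ← exp_add]
        ring_nf
    _ ≤ exp (l * (X + 1 + q - 2 * c)) *
          exp (2 * l * (c - q) + 4 * l ^ 2 * (X - 2 * c + q) / 4) := by gcongr
    _ ≤ exp l * exp (l / (1 - l) * X) := by
        rw [← exp_add, ← exp_add, exp_le_exp]
        have h1 : 0 < 1 - l := by linarith
        have : l + l / (1 - l) * X - (l * (X + 1 + q - 2 * c) +
            (2 * l * (c - q) + 4 * l ^ 2 * (X - 2 * c + q) / 4)) =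
            l / (1 - l) * (l ^ 2 * X + 2 * l * (1 - l) * c + (1 - l) ^ 2 * q) := by
          field_simp
          ring
        have h2 := mul_nonneg (div_pos hl0 h1).le hsq
        linarith

/-- The expectation of `F` at the sum of `n` centred indicator vectors of i.i.d. samples drawn
with weights `p`. -/
noncomputable def sampleExp {S : Type*} [Fintype S] [DecidableEq S] (p : S → ℝ) (n : ℕ)
    (F : (S → ℝ) → ℝ) : ℝ :=
  ∑ ω : Fin n → S, (∏ i, p (ω i)) * F fun s => ∑ i, ((if ω i = s then 1 else 0) - p s)

section sampleExp

variable {S : Type*} [Fintype S] [DecidableEq S] {p : S → ℝ}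

lemma sampleExp_zero (F : (S → ℝ) → ℝ) : sampleExp p 0 F = F 0 := by
  simp [sampleExp]
  rfl

lemma sampleExp_succ (n : ℕ) (F : (S → ℝ) → ℝ) :
    sampleExp p (n + 1) F = sampleExp p n fun x =>
      ∑ a, p a * F fun s => x s + ((if a = s then 1 else 0) - p s) := by
  unfold sampleExp
  rw [← (Fin.consEquiv fun _ : Fin (n + 1) => S).sum_comp, Fintype.sum_prod_type, sum_comm]
  refine sum_congr rfl fun ω _ => ?_
  rw [mul_sum]
  refine sum_congr rfl fun a _ => ?_
  simp only [Fin.consEquiv_apply, Fin.prod_univ_succ, Fin.sum_univ_succ, Fin.cons_zero,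
    Fin.cons_succ]
  rw [mul_assoc, mul_left_comm]
  congr 3
  funext s
  ring

lemma sampleExp_mono (hp0 : ∀ a, 0 ≤ p a) (n : ℕ) {F G : (S → ℝ) → ℝ} (h : ∀ x, F x ≤ G x) :
    sampleExp p n F ≤ sampleExp p n G :=
  sum_le_sum fun _ _ => mul_le_mul_of_nonneg_left (h _) (prod_nonneg fun _ _ => hp0 _)

lemma sampleExp_add (n : ℕ) (F G : (S → ℝ) → ℝ) :
    sampleExp p n (fun x => F x + G x) = sampleExp p n F + sampleExp p n G := by
  simp [sampleExp, mul_add, sum_add_distrib]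

lemma sampleExp_const_mul (n : ℕ) (c : ℝ) (F : (S → ℝ) → ℝ) :
    sampleExp p n (fun x => c * F x) = c * sampleExp p n F := by
  simp only [sampleExp, mul_sum]
  exact sum_congr rfl fun _ _ => by ring

lemma sampleExp_sum (n : ℕ) (F : S → (S → ℝ) → ℝ) :
    sampleExp p n (fun x => ∑ a, F a x) = ∑ a, sampleExp p n (F a) := by
  simp only [sampleExp, mul_sum]
  exact sum_comm

lemma sampleExp_const (hp1 : ∑ a, p a = 1) (n : ℕ) (c : ℝ) : sampleExp p n (fun _ => c) = c := by
  induction n with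
  | zero => exact sampleExp_zero _
  | succ n ih => simpa [sampleExp_succ, ← sum_mul, hp1] using ih

lemma sampleExp_apply (hp1 : ∑ a, p a = 1) (n : ℕ) (s : S) :
    sampleExp p n (fun x => x s) = 0 := by
  induction n with
  | zero => simp [sampleExp_zero]
  | succ n ih =>
    have h : ∀ x : S → ℝ, ∑ a, p a * (x s + ((if a = s then 1 else 0) - p s)) = x s := fun x => by
      simp [mul_add, mul_sub, sum_add_distrib, ← sum_mul, hp1]
    simp only [sampleExp_succ, h, ih]

lemma sampleExp_apply_sq (hp1 : ∑ a, p a = 1) (n : ℕ) (s : S) :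
    sampleExp p n (fun x => x s ^ 2) = n * (p s * (1 - p s)) := by
  induction n with
  | zero => simp [sampleExp_zero]
  | succ n ih =>
    have h : ∀ x : S → ℝ, ∑ a, p a * (x s + ((if a = s then 1 else 0) - p s)) ^ 2 =
        x s ^ 2 + p s * (1 - p s) := by
      intro x
      have h' : ∀ a, p a * (x s + ((if a = s then 1 else 0) - p s)) ^ 2 =
          p a * (x s - p s) ^ 2 + if a = s then p a * (2 * (x s - p s) + 1) else 0 := by
        intro a
        split_ifs <;> ring
      simp only [h', sum_add_distrib, ← sum_mul, hp1, sum_ite_eq', mem_univ, if_true]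
      ring
    rw [sampleExp_succ]
    simp only [h]
    rw [sampleExp_add, ih, sampleExp_const hp1]
    push_cast
    ring

/-- The exponential moment of the squared norm is at most that of an exponential variable. -/
lemma sampleExp_exp_sq_le (hp0 : ∀ a, 0 ≤ p a) (hp1 : ∑ a, p a = 1) (n : ℕ) {L : ℝ} (hL : n < L) :
    sampleExp p n (fun x => exp (1 / L * ∑ s, x s ^ 2)) ≤ L / (L - n) := by
  induction n generalizing L with
  | zero =>
    have : L ≠ 0 := by
      simp at hL
      exact hL.ne'
    simp [sampleExp_zero, this]
  | succ n ih =>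
    push_cast at hL ⊢
    have hn : (0 : ℝ) ≤ n := n.cast_nonneg
    have hL0 : 0 < L := by linarith
    have hL1 : 0 < L - 1 := by linarith
    have hLn : 0 < L - 1 - n := by linarith
    have hl : 1 / L / (1 - 1 / L) = 1 / (L - 1) := by
      field_simp
    rw [sampleExp_succ]
    calc _ ≤ sampleExp p n fun x => exp (1 / L) * exp (1 / (L - 1) * ∑ s, x s ^ 2) := by
          refine sampleExp_mono hp0 n fun x => ?_
          rw [← hl]
          refine sum_mul_exp_sq_add_indicator_le hp0 hp1 (by positivity) ?_ x
          rw [div_lt_one hL0]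
          linarith
      _ ≤ exp (1 / L) * ((L - 1) / (L - 1 - n)) := by
          rw [sampleExp_const_mul]
          gcongr
          exact ih (by linarith)
      _ ≤ L / (L - (n + 1)) := by
          have h1 : 1 - 1 / L ≤ exp (-(1 / L)) := by linarith [add_one_le_exp (-(1 / L))]
          have h2 : exp (1 / L) * (1 - 1 / L) ≤ 1 := by
            calc _ ≤ exp (1 / L) * exp (-(1 / L)) := by gcongr
              _ = 1 := by rw [← exp_add]; simp
          have h3 : exp (1 / L) * (L - 1) ≤ L := by
            calc _ = exp (1 / L) * (1 - 1 / L) * L := by field_simp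
              _ ≤ 1 * L := by gcongr
              _ = L := one_mul L
          rw [← mul_div_assoc, show L - (n + 1) = L - 1 - n by ring]
          gcongr

/-- The fourth moment of the norm. -/
lemma sampleExp_sq_sq_le (hp0 : ∀ a, 0 ≤ p a) (hp1 : ∑ a, p a = 1) (n : ℕ) :
    sampleExp p n (fun x => (∑ s, x s ^ 2) ^ 2) ≤ 4 / 3 * n ^ 2 := by
  have hple : ∀ a, p a ≤ 1 := fun a => hp1 ▸ single_le_sum (fun i _ => hp0 i) (mem_univ a)
  set q := ∑ s, p s ^ 2 with hq
  have hcube_ge : q ^ 2 ≤ ∑ s, p s ^ 3 := by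
    have h : ∑ s, (2 * q * p s ^ 2 - q ^ 2 * p s) ≤ ∑ s, p s ^ 3 :=
      sum_le_sum fun s _ => by nlinarith [mul_nonneg (hp0 s) (sq_nonneg (p s - q))]
    rw [sum_sub_distrib, ← mul_sum, ← mul_sum, hp1, ← hq] at h
    linarith
  have hcube_le : ∑ s, p s ^ 3 ≤ q :=
    sum_le_sum fun s _ => by nlinarith [mul_nonneg (sq_nonneg (p s)) (sub_nonneg.2 (hple s))]
  have hq0 : 0 ≤ q := sum_nonneg fun s _ => sq_nonneg _
  have hstep : ∀ x : S → ℝ,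
      ∑ a, p a * (∑ s, (x s + ((if a = s then 1 else 0) - p s)) ^ 2) ^ 2 ≤
        (∑ s, x s ^ 2) ^ 2 + 2 * (1 - q) * (∑ s, x s ^ 2) + 4 * (∑ s, p s * x s ^ 2) +
          8 * (∑ s, (p s * q - p s ^ 2) * x s) + 4 / 3 := by
    intro x
    simp only [sum_add_indicator_sub_sq, ← hq]
    set X := ∑ s, x s ^ 2
    set c := ∑ s, p s * x s with hc
    have hlin : ∑ s, (p s * q - p s ^ 2) * x s = q * c - ∑ s, p s ^ 2 * x s := by
      rw [hc, mul_sum, ← sum_sub_distrib]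
      exact sum_congr rfl fun s _ => by ring
    have hexp : ∑ a, p a * (X + 2 * (x a - c) + (1 + q - 2 * p a)) ^ 2 =
        (X - 2 * c + 1 + q) ^ 2 + 4 * (∑ s, p s * x s ^ 2) + 4 * ∑ s, p s ^ 3 +
          4 * (X - 2 * c + 1 + q) * (c - q) - 8 * ∑ s, p s ^ 2 * x s := by
      have h : ∀ a, p a * (X + 2 * (x a - c) + (1 + q - 2 * p a)) ^ 2 =
          (X - 2 * c + 1 + q) ^ 2 * p a + 4 * (p a * x a ^ 2) + 4 * p a ^ 3 +
          4 * (X - 2 * c + 1 + q) * (p a * x a) - 4 * (X - 2 * c + 1 + q) * p a ^ 2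
            - 8 * (p a ^ 2 * x a) := fun a => by ring
      simp only [h, sum_add_distrib, sum_sub_distrib, ← mul_sum, hp1, ← hq, ← hc]
      ring
    rw [hexp, hlin]
    nlinarith [sq_nonneg c, sq_nonneg (3 * q - 1)]
  induction n with
  | zero => simp [sampleExp_zero]
  | succ n ih =>
    rw [sampleExp_succ]
    refine (sampleExp_mono hp0 n hstep).trans ?_
    have hvar : ∑ s, n * (p s * (1 - p s)) = n * (1 - q) := by
      rw [← mul_sum, hq, ← hp1, ← sum_sub_distrib]
      congr 1
      exact sum_congr rfl fun s _ => by rw [hp1]; ring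
    have hvar' : ∑ s, p s * (n * (p s * (1 - p s))) = n * (q - ∑ s, p s ^ 3) := by
      rw [hq, ← sum_sub_distrib, mul_sum]
      exact sum_congr rfl fun s _ => by ring
    simp only [sampleExp_add, sampleExp_const_mul, sampleExp_sum, sampleExp_apply hp1,
      sampleExp_apply_sq hp1, sampleExp_const hp1, hvar, hvar', mul_zero, sum_const_zero]
    have hn : (0 : ℝ) ≤ n := n.cast_nonneg
    push_cast
    nlinarith [mul_nonneg hn (sub_nonneg.2 hcube_ge), mul_nonneg hn (sq_nonneg q)]

/-- Markov's inequality for `sampleExp`. -/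
lemma sampleExp_indicator_le_div (hp0 : ∀ a, 0 ≤ p a) (n : ℕ) {F G : (S → ℝ) → ℝ} {r c : ℝ}
    (hc : 0 < c) (hG : ∀ x, 0 ≤ G x) (h : ∀ x, r ≤ F x → c ≤ G x) :
    sampleExp p n (fun x => if r ≤ F x then 1 else 0) ≤ sampleExp p n G / c := by
  rw [div_eq_inv_mul, ← sampleExp_const_mul]
  refine sampleExp_mono hp0 n fun x => ?_
  split_ifs with hx
  · rw [← div_eq_inv_mul, one_le_div hc]
    exact h x hx
  · exact mul_nonneg (inv_nonneg.2 hc.le) (hG x)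

lemma sampleExp_tail_le (hp0 : ∀ a, 0 ≤ p a) (hp1 : ∑ a, p a = 1) {n : ℕ} (hn : 0 < n) {y : ℝ}
    (hy : 2 ≤ y) :
    sampleExp p n (fun x => if n * y ≤ ∑ s, x s ^ 2 then 1 else 0) ≤ exp (-y / 2) := by
  have hn' : (0 : ℝ) < n := by exact_mod_cast hn
  have hy0 : 0 < y := by linarith
  rcases le_total y 6 with hy6 | hy6
  · calc _ ≤ sampleExp p n (fun x => (∑ s, x s ^ 2) ^ 2) / (n * y) ^ 2 :=
          sampleExp_indicator_le_div hp0 n (by positivity) (fun _ => sq_nonneg _)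
            fun x hx => by gcongr
      _ ≤ 4 / 3 * n ^ 2 / (n * y) ^ 2 := by
          gcongr
          exact sampleExp_sq_sq_le hp0 hp1 n
      _ = (4 / 3) / y ^ 2 := by field_simp
      _ ≤ exp (-y / 2) := by
          have he := exp_one_lt_d9
          have hhalf : exp (1 / 2) ^ 2 = exp 1 := by rw [← exp_nat_mul]; norm_num
          have hhalf' : exp (3 / 2) = exp (1 / 2) ^ 3 := by rw [← exp_nat_mul]; norm_num
          have hupper : exp (1 / 2) ≤ 1.65 := by nlinarith [exp_pos (1 / 2)]
          have hchord := convexOn_exp.2 (Set.mem_univ (1 / 2 : ℝ)) (Set.mem_univ (3 / 2 : ℝ))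
            (show 0 ≤ (6 - y) / 4 by linarith) (show 0 ≤ (y - 2) / 4 by linarith) (by ring)
          simp only [smul_eq_mul] at hchord
          rw [show (6 - y) / 4 * (1 / 2) + (y - 2) / 4 * (3 / 2) = y / 4 by ring] at hchord
          have hupper' : exp (3 / 2) ≤ 4.5 := by
            rw [hhalf']
            calc _ ≤ (1.65 : ℝ) ^ 3 := by gcongr
              _ ≤ 4.5 := by norm_num
          have hlin : exp (y / 4) ≤ 0.86 * y := by nlinarith
          have hsq : exp (y / 2) ≤ 3 / 4 * y ^ 2 := by
            rw [show exp (y / 2) = exp (y / 4) ^ 2 by rw [← exp_nat_mul]; ring_nf]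
            calc _ ≤ (0.86 * y) ^ 2 := by gcongr
              _ ≤ _ := by nlinarith
          rw [neg_div, exp_neg, div_le_iff₀ (by positivity), ← div_eq_inv_mul,
            le_div_iff₀ (exp_pos _)]
          linarith
  · have hL : (n : ℝ) < 4 / 3 * n := by linarith
    calc _ ≤ sampleExp p n (fun x => exp (1 / (4 / 3 * n) * ∑ s, x s ^ 2)) / exp (3 / 4 * y) := by
          refine sampleExp_indicator_le_div hp0 n (exp_pos _) (fun _ => (exp_pos _).le)
            fun x hx => exp_le_exp.2 ?_
          calc 3 / 4 * y = 1 / (4 / 3 * n) * (n * y) := by field_simp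
            _ ≤ _ := by gcongr
      _ ≤ 4 / 3 * n / (4 / 3 * n - n) / exp (3 / 4 * y) := by
          gcongr
          exact sampleExp_exp_sq_le hp0 hp1 n hL
      _ = 4 / exp (3 / 4 * y) := by
          congr 1
          rw [div_eq_iff (by linarith)]
          ring
      _ ≤ exp (-y / 2) := by
          rw [div_le_iff₀ (exp_pos _), ← exp_add]
          have h1 : exp 1 ≤ exp ((-y / 2 + 3 / 4 * y) / 3 * 2) := exp_le_exp.2 (by linarith)
          have h2 : exp ((-y / 2 + 3 / 4 * y) / 3 * 2) ^ 3 = exp (-y / 2 + 3 / 4 * y) ^ 2 := by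
            rw [← exp_nat_mul, ← exp_nat_mul]
            push_cast
            ring_nf
          have h3 : (2.7 : ℝ) ^ 3 ≤ exp ((-y / 2 + 3 / 4 * y) / 3 * 2) ^ 3 := by
            gcongr
            linarith [exp_one_gt_d9]
          nlinarith [exp_pos (-y / 2 + 3 / 4 * y)]

end sampleExp

/-- if `N ≥ (4/ε²)(1 − 1/S₀)`, then for `N` i.i.d. samples from a pmf `p`
on a finite set `S` of cardinality `S₀`,
`P(‖p̂_N − p‖₂ ≥ ε) ≤ exp(−ε²·N/2)`. -/
theorem empirical_l2_concentration {S : Type*} [Fintype S] [DecidableEq S]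
    [MeasurableSpace S] [MeasurableSingletonClass S]
    (p : PMF S) (N : ℕ) (hN : 0 < N) (ε : ℝ) (hε : 0 < ε)
    (hNlarge : (4 / ε ^ 2) * (1 - 1 / (Fintype.card S : ℝ)) ≤ N) :
    (Measure.pi fun _ : Fin N => p.toMeasure)
        {ω | ε ≤ Real.sqrt (∑ s, (empDist ω s - (p s).toReal) ^ 2)} ≤
      ENNReal.ofReal (Real.exp (-(ε ^ 2 * N) / 2)) := by
  have hN' : (0 : ℝ) < N := by exact_mod_cast hN
  have hp0 : ∀ a, 0 ≤ (p a).toReal := fun a => ENNReal.toReal_nonneg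
  have hp1 : ∑ a, (p a).toReal = 1 := by
    rw [← ENNReal.toReal_sum fun a _ => p.apply_ne_top a, ← tsum_fintype (L := .unconditional _),
      p.tsum_coe, ENNReal.toReal_one]
  have hemp : ∀ (ω : Fin N → S) (s : S), empDist ω s - (p s).toReal =
      (N : ℝ)⁻¹ * ∑ i, ((if ω i = s then 1 else 0) - (p s).toReal) := by
    intro ω s
    rw [sum_sub_distrib, mul_sub, empDist]
    simp [hN'.ne']
  rcases subsingleton_or_nontrivial S with hS | hS
  · have hset : {ω : Fin N → S | ε ≤ Real.sqrt (∑ s, (empDist ω s - (p s).toReal) ^ 2)} = ∅ := by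
      ext ω
      have hp : ∀ s, (p s).toReal = 1 := fun s => by
        rw [← hp1, Fintype.sum_subsingleton _ s]
      have hω : ∀ s, empDist ω s - (p s).toReal = 0 := fun s => by
        rw [hemp, hp]
        simp [fun i => Subsingleton.elim (ω i) s]
      rw [Set.mem_ofPred_eq]
      simp [hω, hε]
    simp [hset]
  · have hy : 2 ≤ ε ^ 2 * N := by
      have hcard : (2 : ℝ) ≤ Fintype.card S := by exact_mod_cast Fintype.one_lt_card
      have hinv : 1 / (Fintype.card S : ℝ) ≤ 1 / 2 := by gcongr
      have hmul := mul_le_mul_of_nonneg_left hNlarge (sq_nonneg ε)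
      rw [← mul_assoc, mul_div_cancel₀ _ (by positivity)] at hmul
      linarith
    have hset : ∀ ω : Fin N → S, ε ≤ Real.sqrt (∑ s, (empDist ω s - (p s).toReal) ^ 2) ↔
        N * (ε ^ 2 * N) ≤ ∑ s, (∑ i, ((if ω i = s then 1 else 0) - (p s).toReal)) ^ 2 := by
      intro ω
      rw [le_sqrt' hε]
      simp only [hemp, mul_pow, ← mul_sum]
      rw [inv_pow, ← div_eq_inv_mul, le_div_iff₀ (by positivity)]
      ring_nf
    refine le_trans (le_of_eq ?_) (ENNReal.ofReal_le_ofReal (sampleExp_tail_le hp0 hp1 hN hy))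
    classical
    rw [sampleExp, ENNReal.ofReal_sum_of_nonneg fun ω _ =>
      mul_nonneg (prod_nonneg fun _ _ => hp0 _) (by split_ifs <;> simp)]
    rw [show {ω : Fin N → S | ε ≤ Real.sqrt (∑ s, (empDist ω s - (p s).toReal) ^ 2)} =
      ↑(univ.filter fun ω : Fin N → S =>
        N * (ε ^ 2 * N) ≤ ∑ s, (∑ i, ((if ω i = s then 1 else 0) - (p s).toReal)) ^ 2) by
      ext ω; simp [hset], ← sum_measure_singleton, sum_filter]
    refine sum_congr rfl fun ω _ => ?_
    split_ifs
    · rw [mul_one, ← ENNReal.toReal_prod, Measure.pi_singleton]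
      simp only [PMF.toMeasure_apply_singleton _ _ (measurableSet_singleton _)]
      rw [ENNReal.ofReal_toReal (ENNReal.prod_ne_top fun i _ => p.apply_ne_top _)]
    · simp
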